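/- The strongly stable matching polytope is integral: a vector x ∈ ℝ^E is an extreme point of the polytope defined by the strongly stable matching linear system (a)–(d) if and only if x = χ^M for some strongly stable matching M of G. -/

import Mathlib

open scoped Classical

/-- An instance of the super-stable matching problem: a finite bipartite graph with
men `A`, women `B`, edge set `E`, and for each vertex a total preorder (preference
list with ties) on its neighbors. `prefA a b b'` means `b ⪰_a b'`. -/
structure SMInstance (A B : Type*) where
  E : Finset (A × B)
  prefA : A → B → B → Prop
  prefB : B → A → A → Prop
  prefA_refl : ∀ a b, (a, b) ∈ E → prefA a b b
  prefA_trans : ∀ a b₁ b₂ b₃, prefA a b₁ b₂ → prefA a b₂ b₃ → prefA a b₁ b₃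
  prefA_total : ∀ a b₁ b₂, (a, b₁) ∈ E → (a, b₂) ∈ E → prefA a b₁ b₂ ∨ prefA a b₂ b₁
  prefB_refl : ∀ b a, (a, b) ∈ E → prefB b a a
  prefB_trans : ∀ b a₁ a₂ a₃, prefB b a₁ a₂ → prefB b a₂ a₃ → prefB b a₁ a₃
  prefB_total : ∀ b a₁ a₂, (a₁, b) ∈ E → (a₂, b) ∈ E → prefB b a₁ a₂ ∨ prefB b a₂ a₁

namespace SMInstance

variable {A B : Type*}

/-- A matching: a set of pairwise disjoint edges of the graph. -/
def IsMatching (I : SMInstance A B) (M : Finset (A × B)) : Prop :=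
  M ⊆ I.E ∧
  (∀ p ∈ M, ∀ q ∈ M, p.1 = q.1 → p = q) ∧
  (∀ p ∈ M, ∀ q ∈ M, p.2 = q.2 → p = q)

/-- `(a,b)` is a blocking edge for `M`: it is an edge outside `M`, `a` is unmatched
or weakly prefers `b` to its partner, and `b` is unmatched or weakly prefers `a` to
its partner. -/
def Blocks (I : SMInstance A B) (M : Finset (A × B)) (a : A) (b : B) : Prop :=
  (a, b) ∈ I.E ∧ (a, b) ∉ M ∧
  (∀ b', (a, b') ∈ M → I.prefA a b b') ∧
  (∀ a', (a', b) ∈ M → I.prefB b a a')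

/-- A super-stable matching: a matching with no blocking edge. -/
def SuperStable (I : SMInstance A B) (M : Finset (A × B)) : Prop :=
  I.IsMatching M ∧ ∀ a b, ¬ I.Blocks M a b

/-- `M` dominates `N`: every man matched in `N` is matched in `M` to a partner he
weakly prefers. -/
def Dominates (I : SMInstance A B) (M N : Finset (A × B)) : Prop :=
  ∀ a b, (a, b) ∈ N → ∃ b', (a, b') ∈ M ∧ I.prefA a b' b

/-- Strict preference `b ≻_a b'`. -/
def SPrefA (I : SMInstance A B) (a : A) (b b' : B) : Prop :=
  I.prefA a b b' ∧ ¬ I.prefA a b' b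

/-- Strict preference `a ≻_b a'`. -/
def SPrefB (I : SMInstance A B) (b : B) (a a' : A) : Prop :=
  I.prefB b a a' ∧ ¬ I.prefB b a' a

end SMInstance

namespace SMInstance

variable {A B : Type*}

/-- The incidence vector `χ^M` of a set of edges `M`. -/
noncomputable def chi (M : Finset (A × B)) : A × B → ℝ :=
  fun p => if p ∈ M then 1 else 0

/-- `∑_{i ∈ N(a)} x_{a,i}`, the sum of `x` over the edges incident to the man `a`. -/
noncomputable def rowSum (I : SMInstance A B) (x : A × B → ℝ) (a : A) : ℝ :=
  ∑ p ∈ I.E.filter (fun p => p.1 = a), x p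

/-- `∑_{j ∈ N(b)} x_{j,b}`, the sum of `x` over the edges incident to the woman `b`. -/
noncomputable def colSum (I : SMInstance A B) (x : A × B → ℝ) (b : B) : ℝ :=
  ∑ p ∈ I.E.filter (fun p => p.2 = b), x p

/-- Constraint (b) of the super-stable matching linear system at edge `p = (u,v)`:
`∑_{i ≻_u v} x_{u,i} + ∑_{j ≻_v u} x_{j,v} + x_{u,v} ≥ 1`. -/
def StabIneq (I : SMInstance A B) (x : A × B → ℝ) (p : A × B) : Prop :=
  (∑ q ∈ I.E.filter (fun q => q.1 = p.1 ∧ I.SPrefA p.1 q.2 p.2), x q) +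
  (∑ q ∈ I.E.filter (fun q => q.2 = p.2 ∧ I.SPrefB p.2 q.1 p.1), x q) +
  x p ≥ 1

/-- `x ∈ ℝ^E` is a feasible solution of the super-stable matching linear system
(a)–(c). -/
def Feasible (I : SMInstance A B) (x : A × B → ℝ) : Prop :=
  (∀ p, p ∉ I.E → x p = 0) ∧
  (∀ a : A, I.rowSum x a ≤ 1) ∧
  (∀ b : B, I.colSum x b ≤ 1) ∧
  (∀ p ∈ I.E, I.StabIneq x p) ∧
  (∀ p, 0 ≤ x p)

end SMInstance

namespace SMInstance

variable {A B : Type*}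

/-- Indifference `b =_a b'`. -/
def EqA (I : SMInstance A B) (a : A) (b b' : B) : Prop :=
  I.prefA a b b' ∧ I.prefA a b' b

/-- Indifference `a =_b a'`. -/
def EqB (I : SMInstance A B) (b : B) (a a' : A) : Prop :=
  I.prefB b a a' ∧ I.prefB b a' a

/-- `(a,b)` is a blocking edge for strong stability: one endpoint would become
strictly better off and the other not worse off. -/
def StrongBlocks (I : SMInstance A B) (M : Finset (A × B)) (a : A) (b : B) : Prop :=
  (a, b) ∈ I.E ∧ (a, b) ∉ M ∧
  (((∀ b', (a, b') ∈ M → I.SPrefA a b b') ∧ (∀ a', (a', b) ∈ M → I.prefB b a a')) ∨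
   ((∀ b', (a, b') ∈ M → I.prefA a b b') ∧ (∀ a', (a', b) ∈ M → I.SPrefB b a a')))

/-- A strongly stable matching: a matching with no blocking edge for strong
stability. -/
def StronglyStable (I : SMInstance A B) (M : Finset (A × B)) : Prop :=
  I.IsMatching M ∧ ∀ a b, ¬ I.StrongBlocks M a b

/-- Constraint (b) of the strongly stable matching linear system at `p = (u,v)`:
`∑_{i ≻_u v} x_{u,i} + ∑_{j ≻_v u} x_{j,v} + ∑_{k =_u v} x_{u,k} ≥ 1` (the sum over
`k =_u v` includes `k = v`). -/
def StrongIneqB (I : SMInstance A B) (x : A × B → ℝ) (p : A × B) : Prop :=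
  (∑ q ∈ I.E.filter (fun q => q.1 = p.1 ∧ I.SPrefA p.1 q.2 p.2), x q) +
  (∑ q ∈ I.E.filter (fun q => q.2 = p.2 ∧ I.SPrefB p.2 q.1 p.1), x q) +
  (∑ q ∈ I.E.filter (fun q => q.1 = p.1 ∧ I.EqA p.1 q.2 p.2), x q) ≥ 1

/-- Constraint (c) of the strongly stable matching linear system at `p = (u,v)`:
`∑_{i ≻_u v} x_{u,i} + ∑_{j ≻_v u} x_{j,v} + ∑_{k =_v u} x_{k,v} ≥ 1` (the sum over
`k =_v u` includes `k = u`). -/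
def StrongIneqC (I : SMInstance A B) (x : A × B → ℝ) (p : A × B) : Prop :=
  (∑ q ∈ I.E.filter (fun q => q.1 = p.1 ∧ I.SPrefA p.1 q.2 p.2), x q) +
  (∑ q ∈ I.E.filter (fun q => q.2 = p.2 ∧ I.SPrefB p.2 q.1 p.1), x q) +
  (∑ q ∈ I.E.filter (fun q => q.2 = p.2 ∧ I.EqB p.2 q.1 p.1), x q) ≥ 1

/-- `x ∈ ℝ^E` is a feasible solution of the strongly stable matching linear system
(a)–(d). -/
def StrongFeasible (I : SMInstance A B) (x : A × B → ℝ) : Prop :=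
  (∀ p, p ∉ I.E → x p = 0) ∧
  (∀ a : A, I.rowSum x a ≤ 1) ∧
  (∀ b : B, I.colSum x b ≤ 1) ∧
  (∀ p ∈ I.E, I.StrongIneqB x p) ∧
  (∀ p ∈ I.E, I.StrongIneqC x p) ∧
  (∀ p, 0 ≤ x p)

end SMInstance

open Filter Topology

/-- A relation `le` on a finite set `E`, with `le q p` read as "`q` is weakly preferred to `p`",
that is a total preorder on every fiber of `f` and relates only elements of the same fiber. -/
structure FiberPreorder {α κ : Type*} (E : Finset α) (f : α → κ) (le : α → α → Prop) : Prop where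
  refl : ∀ p ∈ E, le p p
  trans : ∀ p q r, le p q → le q r → le p r
  total : ∀ p ∈ E, ∀ q ∈ E, f p = f q → le p q ∨ le q p
  fiber_eq : ∀ p q, le p q → f p = f q

/-- The sum of `x` over the elements weakly preferred to `p`. -/
noncomputable def weakSum {α : Type*} (E : Finset α) (le : α → α → Prop) (x : α → ℝ) (p : α) : ℝ :=
  ∑ q ∈ E.filter (fun q => le q p), x q

/-- The sum of `x` over the elements strictly preferred to `p`. -/
noncomputable def strictSum {α : Type*} (E : Finset α) (le : α → α → Prop) (x : α → ℝ)
    (p : α) : ℝ :=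
  ∑ q ∈ E.filter (fun q => le q p ∧ ¬ le p q), x q

theorem sum_filter_add_mul_sub {α : Type*} (E : Finset α) (P : α → Prop) [DecidablePred P] (x y : α → ℝ) (δ : ℝ) :
    ∑ q ∈ E.filter P, (x q + δ * (x q - y q)) =
      ∑ q ∈ E.filter P, x q + δ * (∑ q ∈ E.filter P, x q - ∑ q ∈ E.filter P, y q) := by
  rw [Finset.sum_add_distrib, ← Finset.mul_sum, Finset.sum_sub_distrib]

theorem sum_filter_le_sum_filter {α : Type*} {E : Finset α} {x : α → ℝ} (hx : ∀ p, 0 ≤ x p)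
    {P Q : α → Prop} [DecidablePred P] [DecidablePred Q] (h : ∀ q ∈ E, P q → Q q) :
    ∑ q ∈ E.filter P, x q ≤ ∑ q ∈ E.filter Q, x q := by
  refine Finset.sum_le_sum_of_subset_of_nonneg ?_ fun i _ _ => hx i
  intro q hq
  rw [Finset.mem_filter] at hq ⊢
  exact ⟨hq.1, h q hq.1 hq.2⟩

theorem exists_pos_of_sum_filter_pos {α : Type*} {E : Finset α} {x : α → ℝ} {P : α → Prop} [DecidablePred P]
    (h : 0 < ∑ q ∈ E.filter P, x q) : ∃ q ∈ E, P q ∧ 0 < x q := by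
  by_contra! hc
  refine absurd h (not_lt.2 (Finset.sum_nonpos fun q hq => ?_))
  rw [Finset.mem_filter] at hq
  exact hc q hq.1 hq.2

theorem weakSum_eq_strictSum_add {α : Type*} (E : Finset α) (le : α → α → Prop) (x : α → ℝ)
    (p : α) :
    weakSum E le x p =
      strictSum E le x p + ∑ q ∈ E.filter (fun q => le q p ∧ le p q), x q := by
  unfold weakSum strictSum
  rw [← Finset.sum_filter_add_sum_filter_not (E.filter fun q => le q p) (fun q => le p q),
    Finset.filter_filter, Finset.filter_filter, add_comm]

namespace FiberPreorder

variable {α κ : Type*} {E : Finset α} {f : α → κ} {le : α → α → Prop} {x : α → ℝ}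

theorem weakSum_mono (h : FiberPreorder E f le) (hx : ∀ p, 0 ≤ x p) {p q : α} (hqp : le q p) :
    weakSum E le x q ≤ weakSum E le x p :=
  sum_filter_le_sum_filter hx fun r _ hr => h.trans r q p hr hqp

theorem strictSum_mono (h : FiberPreorder E f le) (hx : ∀ p, 0 ≤ x p) {p q : α} (hqp : le q p) :
    strictSum E le x q ≤ strictSum E le x p :=
  sum_filter_le_sum_filter hx fun r _ hr =>
    ⟨h.trans r q p hr.1 hqp, fun hpr => hr.2 (h.trans q p r hqp hpr)⟩

theorem weakSum_le_strictSum (h : FiberPreorder E f le) (hx : ∀ p, 0 ≤ x p) {p q : α}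
    (hqp : le q p) (hpq : ¬ le p q) : weakSum E le x q ≤ strictSum E le x p :=
  sum_filter_le_sum_filter hx fun r _ hr =>
    ⟨h.trans r q p hr hqp, fun hpr => hpq (h.trans p r q hpr hr)⟩

theorem strictSum_lt_weakSum (h : FiberPreorder E f le) (hx : ∀ p, 0 ≤ x p) {p : α} (hp : p ∈ E)
    (hpos : 0 < x p) : strictSum E le x p < weakSum E le x p := by
  rw [weakSum_eq_strictSum_add]
  have : x p ≤ ∑ q ∈ E.filter (fun q => le q p ∧ le p q), x q :=
    Finset.single_le_sum (f := x) (fun i _ => hx i)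
      (Finset.mem_filter.2 ⟨hp, h.refl p hp, h.refl p hp⟩)
  linarith

theorem le_of_not_le (h : FiberPreorder E f le) {p q : α} (hp : p ∈ E) (hq : q ∈ E)
    (hpq : f p = f q) (hn : ¬ le p q) : le q p :=
  (h.total p hp q hq hpq).resolve_left hn

theorem sum_mul_strictSum_add_weakSum (h : FiberPreorder E f le) (x : α → ℝ) :
    ∑ p ∈ E, x p * (strictSum E le x p + weakSum E le x p) =
      ∑ p ∈ E, x p * ∑ q ∈ E.filter (fun q => f q = f p), x q := by
  have key : ∑ p ∈ E, x p * strictSum E le x p =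
      ∑ p ∈ E, x p * ∑ q ∈ E.filter (fun q => le p q ∧ ¬ le q p), x q := by
    simp only [strictSum, Finset.sum_filter, Finset.mul_sum]
    rw [Finset.sum_comm]
    refine Finset.sum_congr rfl fun p _ => Finset.sum_congr rfl fun q _ => ?_
    split_ifs <;> ring
  simp only [mul_add, Finset.sum_add_distrib]
  rw [key, ← Finset.sum_add_distrib]
  refine Finset.sum_congr rfl fun p hp => ?_
  rw [← mul_add, weakSum]
  congr 1
  simp only [Finset.sum_filter, ← Finset.sum_add_distrib]
  refine Finset.sum_congr rfl fun q hq => ?_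
  have h1 := h.total p hp q hq
  have h2 := h.fiber_eq p q
  have h3 := h.fiber_eq q p
  split_ifs <;> grind

/-- Every fiber meeting the support of `x` contains a most preferred element of the support. -/
theorem exists_strictSum_eq_zero (h : FiberPreorder E f le) (hx : ∀ p, 0 ≤ x p) {p : α}
    (hp : p ∈ E) (hpos : 0 < x p) :
    ∃ q ∈ E, f q = f p ∧ 0 < x q ∧ strictSum E le x q = 0 := by
  obtain ⟨q, hq, hmin⟩ := Finset.exists_min_image
    (E.filter fun q => f q = f p ∧ 0 < x q) (strictSum E le x)
    ⟨p, Finset.mem_filter.2 ⟨hp, rfl, hpos⟩⟩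
  rw [Finset.mem_filter] at hq
  refine ⟨q, hq.1, hq.2.1, hq.2.2, ?_⟩
  by_contra hne
  have hS : 0 < strictSum E le x q :=
    lt_of_le_of_ne (Finset.sum_nonneg fun i _ => hx i) (Ne.symm hne)
  obtain ⟨r, hr, ⟨hrq, hqr⟩, hxr⟩ := exists_pos_of_sum_filter_pos hS
  have h1 := hmin r (Finset.mem_filter.2 ⟨hr, (h.fiber_eq r q hrq).trans hq.2.1, hxr⟩)
  have h2 := h.weakSum_le_strictSum hx hrq hqr
  have h3 := h.strictSum_lt_weakSum hx hr hxr
  linarith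

end FiberPreorder

/-- If `y ≥ 0` has sum one on the rows in `U` and at most one on every column, then its
supporting edge set contains a matching covering `U`. -/
theorem exists_matching_of_row_sum_eq_one {A B : Type*} (H : Finset (A × B)) (y : A × B → ℝ)
    (hy : ∀ q ∈ H, 0 ≤ y q) (U : Finset A)
    (hrow : ∀ u ∈ U, ∑ q ∈ H.filter (fun q => q.1 = u), y q = 1)
    (hcol : ∀ v, ∑ q ∈ H.filter (fun q => q.2 = v), y q ≤ 1) :
    ∃ M ⊆ H, (∀ p ∈ M, ∀ q ∈ M, p.1 = q.1 → p = q) ∧ (∀ p ∈ M, ∀ q ∈ M, p.2 = q.2 → p = q) ∧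
      M.image Prod.fst = U := by
  obtain ⟨g, hg, hgm⟩ := (Finset.all_card_le_biUnion_card_iff_exists_injective
    (fun u : U => (H.filter fun q => q.1 = u.1).image Prod.snd)).1 (by
      intro S
      set N := S.biUnion fun u : U => (H.filter fun q => q.1 = u.1).image Prod.snd with hN
      have h1 : (S.card : ℝ) = ∑ u ∈ S, ∑ q ∈ H.filter (fun q => q.1 = u.1), y q := by
        rw [Finset.sum_congr rfl fun (u : U) _ => hrow u.1 u.2]
        simp
      have h2 : ∑ v ∈ N, ∑ q ∈ H.filter (fun q => q.2 = v), y q ≤ N.card := by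
        refine (Finset.sum_le_sum fun v _ => hcol v).trans ?_
        simp
      have h3 : ∑ u ∈ S, ∑ q ∈ H.filter (fun q => q.1 = u.1), y q ≤
          ∑ v ∈ N, ∑ q ∈ H.filter (fun q => q.2 = v), y q := by
        simp only [Finset.sum_filter]
        rw [Finset.sum_comm, Finset.sum_comm (s := N)]
        refine Finset.sum_le_sum fun q hq => ?_
        rw [Finset.sum_ite_eq N q.2]
        split_ifs with hqN
        · by_cases hu : ∃ u ∈ S, q.1 = u.1
          · obtain ⟨u, hu, hqu⟩ := hu
            rw [Finset.sum_eq_single_of_mem u hu, if_pos hqu]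
            intro u' _ hne
            exact if_neg fun hq' => hne (Subtype.ext (hq'.symm.trans hqu))
          · rw [Finset.sum_eq_zero]
            · exact hy q hq
            · intro u huS
              exact if_neg fun hq' => hu ⟨u, huS, hq'⟩
        · refine (Finset.sum_eq_zero fun u hu => if_neg fun hq' => hqN ?_).le
          rw [hN, Finset.mem_biUnion]
          exact ⟨u, hu, Finset.mem_image.2 ⟨q, Finset.mem_filter.2 ⟨hq, hq'⟩, rfl⟩⟩
      exact_mod_cast h1.le.trans (h3.trans h2))
  refine ⟨Finset.univ.image fun u : U => (u.1, g u), ?_, ?_, ?_, ?_⟩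
  · intro p hp
    obtain ⟨u, -, rfl⟩ := Finset.mem_image.1 hp
    obtain ⟨q, hq, hqg⟩ := Finset.mem_image.1 (hgm u)
    rw [Finset.mem_filter] at hq
    rw [← hq.2, ← hqg]
    exact hq.1
  · intro p hp q hq hpq
    obtain ⟨u, -, rfl⟩ := Finset.mem_image.1 hp
    obtain ⟨v, -, rfl⟩ := Finset.mem_image.1 hq
    rw [Subtype.ext hpq]
  · intro p hp q hq hpq
    obtain ⟨u, -, rfl⟩ := Finset.mem_image.1 hp
    obtain ⟨v, -, rfl⟩ := Finset.mem_image.1 hq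
    rw [hg hpq]
  · ext a
    simp

theorem card_image_support_eq_sum {α κ : Type*} {E : Finset α} {f : α → κ} {x : α → ℝ}
    (hx : ∀ p, 0 ≤ x p)
    (h : ∀ p ∈ E, 0 < x p → ∑ q ∈ E.filter (fun q => f q = f p), x q = 1) :
    (((E.filter fun p => 0 < x p).image f).card : ℝ) = ∑ p ∈ E, x p := by
  have hsupp : ∀ P : α → Prop, ∑ q ∈ (E.filter fun p => 0 < x p).filter P, x q =
      ∑ q ∈ E.filter P, x q := by
    intro P
    rw [Finset.filter_filter]
    refine Finset.sum_subset (fun q hq => ?_) fun q hq hq' => ?_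
    · rw [Finset.mem_filter] at hq ⊢
      exact ⟨hq.1, hq.2.2⟩
    · rw [Finset.mem_filter] at hq hq'
      exact le_antisymm (not_lt.1 fun h0 => hq' ⟨hq.1, h0, hq.2⟩) (hx q)
  have htot := hsupp fun _ => True
  rw [Finset.filter_true, Finset.filter_true] at htot
  rw [← htot, ← Finset.sum_fiberwise_of_maps_to (fun p hp => Finset.mem_image_of_mem f hp),
    Finset.card_eq_sum_ones, Nat.cast_sum]
  refine Finset.sum_congr rfl fun k hk => ?_
  obtain ⟨p, hp, rfl⟩ := Finset.mem_image.1 hk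
  rw [Finset.mem_filter] at hp
  rw [hsupp, h p hp.1 hp.2, Nat.cast_one]

theorem eventually_le_add_mul_sub {c s m : ℝ} (hs : c ≤ s) (h : s = c → m ≤ c) :
    ∀ᶠ δ in 𝓝[>] (0 : ℝ), c ≤ s + δ * (s - m) := by
  rcases hs.eq_or_lt with rfl | hlt
  · filter_upwards [self_mem_nhdsWithin] with δ hδ
    have := mul_nonneg (le_of_lt hδ) (sub_nonneg.2 (h rfl))
    linarith
  · have hcont : Tendsto (fun δ : ℝ => s + δ * (s - m)) (𝓝[>] 0) (𝓝 (s + 0 * (s - m))) :=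
      (Continuous.tendsto (by fun_prop) 0).mono_left nhdsWithin_le_nhds
    rw [zero_mul, add_zero] at hcont
    exact (hcont.eventually (lt_mem_nhds hlt)).mono fun _ h => h.le

namespace SMInstance

variable {A B : Type*}

/-- Weak preference of the man between two edges: `q` and `p` share their man, who weakly prefers
his partner in `q`. -/
def LeA (I : SMInstance A B) (q p : A × B) : Prop :=
  q.1 = p.1 ∧ I.prefA p.1 q.2 p.2

/-- Weak preference of the woman between two edges: `q` and `p` share their woman, who weakly
prefers her partner in `q`. -/
def LeB (I : SMInstance A B) (q p : A × B) : Prop :=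
  q.2 = p.2 ∧ I.prefB p.2 q.1 p.1

theorem fiberPreorder_leA (I : SMInstance A B) : FiberPreorder I.E Prod.fst I.LeA where
  refl p hp := ⟨rfl, I.prefA_refl _ _ hp⟩
  trans := by
    rintro ⟨a, b⟩ ⟨a', b'⟩ ⟨a'', b''⟩ ⟨h1, h2⟩ ⟨h3, h4⟩
    obtain rfl : a = a' := h1
    obtain rfl : a = a'' := h3
    exact ⟨rfl, I.prefA_trans _ _ _ _ h2 h4⟩
  total := by
    rintro ⟨a, b⟩ hp ⟨a', b'⟩ hq h
    obtain rfl : a = a' := h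
    exact (I.prefA_total a b b' hp hq).imp (fun h => ⟨rfl, h⟩) fun h => ⟨rfl, h⟩
  fiber_eq _ _ h := h.1

theorem fiberPreorder_leB (I : SMInstance A B) : FiberPreorder I.E Prod.snd I.LeB where
  refl p hp := ⟨rfl, I.prefB_refl _ _ hp⟩
  trans := by
    rintro ⟨a, b⟩ ⟨a', b'⟩ ⟨a'', b''⟩ ⟨h1, h2⟩ ⟨h3, h4⟩
    obtain rfl : b = b' := h1
    obtain rfl : b = b'' := h3
    exact ⟨rfl, I.prefB_trans _ _ _ _ h2 h4⟩
  total := by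
    rintro ⟨a, b⟩ hp ⟨a', b'⟩ hq h
    obtain rfl : b = b' := h
    exact (I.prefB_total b a a' hp hq).imp (fun h => ⟨rfl, h⟩) fun h => ⟨rfl, h⟩
  fiber_eq _ _ h := h.1

theorem leA_and_not_iff (I : SMInstance A B) (q p : A × B) :
    I.LeA q p ∧ ¬ I.LeA p q ↔ q.1 = p.1 ∧ I.SPrefA p.1 q.2 p.2 := by
  constructor
  · rintro ⟨⟨h, h1⟩, h2⟩
    exact ⟨h, h1, fun h3 => h2 ⟨h.symm, h ▸ h3⟩⟩
  · rintro ⟨h, h1, h2⟩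
    exact ⟨⟨h, h1⟩, fun h3 => h2 (h ▸ h3.2)⟩

theorem leB_and_not_iff (I : SMInstance A B) (q p : A × B) :
    I.LeB q p ∧ ¬ I.LeB p q ↔ q.2 = p.2 ∧ I.SPrefB p.2 q.1 p.1 := by
  constructor
  · rintro ⟨⟨h, h1⟩, h2⟩
    exact ⟨h, h1, fun h3 => h2 ⟨h.symm, h ▸ h3⟩⟩
  · rintro ⟨h, h1, h2⟩
    exact ⟨⟨h, h1⟩, fun h3 => h2 (h ▸ h3.2)⟩

theorem leA_and_leA_iff (I : SMInstance A B) (q p : A × B) :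
    I.LeA q p ∧ I.LeA p q ↔ q.1 = p.1 ∧ I.EqA p.1 q.2 p.2 := by
  constructor
  · rintro ⟨⟨h, h1⟩, h2⟩
    exact ⟨h, h1, h ▸ h2.2⟩
  · rintro ⟨h, h1, h2⟩
    exact ⟨⟨h, h1⟩, h.symm, h ▸ h2⟩

theorem leB_and_leB_iff (I : SMInstance A B) (q p : A × B) :
    I.LeB q p ∧ I.LeB p q ↔ q.2 = p.2 ∧ I.EqB p.2 q.1 p.1 := by
  constructor
  · rintro ⟨⟨h, h1⟩, h2⟩
    exact ⟨h, h1, h ▸ h2.2⟩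
  · rintro ⟨h, h1, h2⟩
    exact ⟨⟨h, h1⟩, h.symm, h ▸ h2⟩

theorem strongIneqB_iff (I : SMInstance A B) (x : A × B → ℝ) (p : A × B) :
    I.StrongIneqB x p ↔ 1 ≤ weakSum I.E I.LeA x p + strictSum I.E I.LeB x p := by
  rw [weakSum_eq_strictSum_add, StrongIneqB, ge_iff_le]
  simp only [strictSum, leA_and_not_iff, leB_and_not_iff, leA_and_leA_iff]
  rw [add_right_comm]

theorem strongIneqC_iff (I : SMInstance A B) (x : A × B → ℝ) (p : A × B) :
    I.StrongIneqC x p ↔ 1 ≤ strictSum I.E I.LeA x p + weakSum I.E I.LeB x p := by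
  rw [weakSum_eq_strictSum_add, StrongIneqC, ge_iff_le]
  simp only [strictSum, leA_and_not_iff, leB_and_not_iff, leB_and_leB_iff]
  rw [add_assoc]

/-- Strong stability of a matching, edge by edge. -/
theorem stronglyStable_iff (I : SMInstance A B) {M : Finset (A × B)} (hM : I.IsMatching M) :
    I.StronglyStable M ↔ ∀ p ∈ I.E,
      ((∃ m ∈ M, I.LeA m p) ∨ ∃ m ∈ M, I.LeB m p ∧ ¬ I.LeB p m) ∧
      ((∃ m ∈ M, I.LeA m p ∧ ¬ I.LeA p m) ∨ ∃ m ∈ M, I.LeB m p) := by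
  constructor
  · rintro ⟨-, hst⟩ p hp
    by_cases hpM : p ∈ M
    · exact ⟨.inl ⟨p, hpM, rfl, I.prefA_refl _ _ hp⟩, .inr ⟨p, hpM, rfl, I.prefB_refl _ _ hp⟩⟩
    have hnb := hst p.1 p.2
    have htA : ∀ m ∈ M, m.1 = p.1 → ¬ I.LeA m p → I.LeA p m := fun m hm h =>
      I.fiberPreorder_leA.le_of_not_le (hM.1 hm) hp h
    have htB : ∀ m ∈ M, m.2 = p.2 → ¬ I.LeB m p → I.LeB p m := fun m hm h =>
      I.fiberPreorder_leB.le_of_not_le (hM.1 hm) hp h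
    constructor
    · by_contra! hc
      refine hnb ⟨hp, hpM, .inl ⟨fun b' hb' => ?_, fun a' ha' => ?_⟩⟩
      · exact ((I.leA_and_not_iff p (p.1, b')).1
          ⟨htA _ hb' rfl (hc.1 _ hb'), hc.1 _ hb'⟩).2
      · by_contra h
        by_cases h' : I.LeB (a', p.2) p
        · exact h (hc.2 _ ha' h').2
        · exact h (htB _ ha' rfl h').2
    · by_contra! hc
      refine hnb ⟨hp, hpM, .inr ⟨fun b' hb' => ?_, fun a' ha' => ?_⟩⟩
      · by_contra h
        by_cases h' : I.LeA (p.1, b') p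
        · exact h (hc.1 _ hb' h').2
        · exact h (htA _ hb' rfl h').2
      · exact ((I.leB_and_not_iff p (a', p.2)).1
          ⟨htB _ ha' rfl (hc.2 _ ha'), hc.2 _ ha'⟩).2
  · intro h
    refine ⟨hM, ?_⟩
    rintro a b ⟨hab, -, ⟨h1, h2⟩ | ⟨h1, h2⟩⟩
    · rcases (h _ hab).1 with ⟨⟨a', b'⟩, hm, h3, h4⟩ | ⟨⟨a', b'⟩, hm, ⟨h3, h4⟩, h5⟩
      · obtain rfl : a' = a := h3
        exact (h1 _ hm).2 h4
      · obtain rfl : b' = b := h3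
        exact h5 ⟨rfl, h2 _ hm⟩
    · rcases (h _ hab).2 with ⟨⟨a', b'⟩, hm, ⟨h3, h4⟩, h5⟩ | ⟨⟨a', b'⟩, hm, h3, h4⟩
      · obtain rfl : a' = a := h3
        exact h5 ⟨rfl, h1 _ hm⟩
      · obtain rfl : b' = b := h3
        exact (h2 _ hm).2 h4

theorem sum_filter_chi {E M : Finset (A × B)} (hM : M ⊆ E) {P : A × B → Prop}
    [DecidablePred P]
    (h : ∀ p ∈ M, ∀ q ∈ M, P p → P q → p = q) :
    ∑ q ∈ E.filter P, chi M q = if ∃ m ∈ M, P m then 1 else 0 := by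
  split_ifs with hex
  · obtain ⟨m, hm, hPm⟩ := hex
    rw [Finset.sum_eq_single_of_mem m (Finset.mem_filter.2 ⟨hM hm, hPm⟩), chi, if_pos hm]
    intro q hq hne
    exact if_neg fun hqM => hne (h q hqM m hm (Finset.mem_filter.1 hq).2 hPm)
  · refine Finset.sum_eq_zero fun q hq => if_neg fun hqM => hex ⟨q, hqM, (Finset.mem_filter.1 hq).2⟩

section chi

variable {I : SMInstance A B} {M : Finset (A × B)}

theorem IsMatching.rowSum_chi (hM : I.IsMatching M) (a : A) :
    I.rowSum (chi M) a = if ∃ m ∈ M, m.1 = a then 1 else 0 :=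
  sum_filter_chi hM.1 fun p hp q hq h1 h2 => hM.2.1 p hp q hq (h1.trans h2.symm)

theorem IsMatching.colSum_chi (hM : I.IsMatching M) (b : B) :
    I.colSum (chi M) b = if ∃ m ∈ M, m.2 = b then 1 else 0 :=
  sum_filter_chi hM.1 fun p hp q hq h1 h2 => hM.2.2 p hp q hq (h1.trans h2.symm)

theorem IsMatching.weakSum_leA_chi (hM : I.IsMatching M) (p : A × B) :
    weakSum I.E I.LeA (chi M) p = if ∃ m ∈ M, I.LeA m p then 1 else 0 :=
  sum_filter_chi hM.1 fun _ hp _ hq h1 h2 => hM.2.1 _ hp _ hq (h1.1.trans h2.1.symm)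

theorem IsMatching.weakSum_leB_chi (hM : I.IsMatching M) (p : A × B) :
    weakSum I.E I.LeB (chi M) p = if ∃ m ∈ M, I.LeB m p then 1 else 0 :=
  sum_filter_chi hM.1 fun _ hp _ hq h1 h2 => hM.2.2 _ hp _ hq (h1.1.trans h2.1.symm)

theorem IsMatching.strictSum_leA_chi (hM : I.IsMatching M) (p : A × B) :
    strictSum I.E I.LeA (chi M) p = if ∃ m ∈ M, I.LeA m p ∧ ¬ I.LeA p m then 1 else 0 :=
  sum_filter_chi hM.1 fun _ hp _ hq h1 h2 => hM.2.1 _ hp _ hq (h1.1.1.trans h2.1.1.symm)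

theorem IsMatching.strictSum_leB_chi (hM : I.IsMatching M) (p : A × B) :
    strictSum I.E I.LeB (chi M) p = if ∃ m ∈ M, I.LeB m p ∧ ¬ I.LeB p m then 1 else 0 :=
  sum_filter_chi hM.1 fun _ hp _ hq h1 h2 => hM.2.2 _ hp _ hq (h1.1.1.trans h2.1.1.symm)

theorem chi_nonneg (M : Finset (A × B)) (p : A × B) : 0 ≤ chi M p := by
  unfold chi
  split_ifs <;> norm_num

theorem StronglyStable.strongFeasible_chi (hM : I.StronglyStable M) :
    I.StrongFeasible (chi M) := by
  have hst := (I.stronglyStable_iff hM.1).1 hM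
  refine ⟨fun p hp => if_neg fun h => hp (hM.1.1 h), fun a => ?_, fun b => ?_, fun p hp => ?_,
    fun p hp => ?_, chi_nonneg M⟩
  · rw [hM.1.rowSum_chi]
    split_ifs <;> norm_num
  · rw [hM.1.colSum_chi]
    split_ifs <;> norm_num
  · rw [strongIneqB_iff, hM.1.weakSum_leA_chi, hM.1.strictSum_leB_chi]
    rcases (hst p hp).1 with h | h <;> rw [if_pos h] <;> split_ifs <;> norm_num
  · rw [strongIneqC_iff, hM.1.strictSum_leA_chi, hM.1.weakSum_leB_chi]
    rcases (hst p hp).2 with h | h <;> rw [if_pos h] <;> split_ifs <;> norm_num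

end chi

theorem StrongFeasible.le_one {I : SMInstance A B} {x : A × B → ℝ} (hx : I.StrongFeasible x)
    (p : A × B) : x p ≤ 1 := by
  by_cases hp : p ∈ I.E
  · refine le_trans ?_ (hx.2.1 p.1)
    exact Finset.single_le_sum (f := x) (fun i _ => hx.2.2.2.2.2 i)
      (Finset.mem_filter.2 ⟨hp, rfl⟩)
  · rw [hx.1 p hp]
    exact zero_le_one

theorem StronglyStable.chi_mem_extremePoints {I : SMInstance A B} {M : Finset (A × B)}
    (hM : I.StronglyStable M) : chi M ∈ Set.extremePoints ℝ {y | I.StrongFeasible y} := by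
  refine ⟨hM.strongFeasible_chi, ?_⟩
  rintro y hy z hz ⟨s, t, hs, ht, hst, h⟩
  ext p
  have hp := congrFun h p
  have hy0 := hy.2.2.2.2.2 p
  have hy1 := hy.le_one p
  have hz0 := hz.2.2.2.2.2 p
  have hz1 := hz.le_one p
  simp only [Pi.add_apply, Pi.smul_apply, smul_eq_mul, chi] at hp ⊢
  split_ifs at hp ⊢ <;> nlinarith

end SMInstance

namespace SMInstance

variable {A B : Type*} {I : SMInstance A B} {x : A × B → ℝ}

/-- Complementary slackness: on the support of a feasible vector, all constraints are tight. -/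
theorem StrongFeasible.tight_of_pos (hx : I.StrongFeasible x) {p : A × B} (hp : p ∈ I.E)
    (hpos : 0 < x p) :
    weakSum I.E I.LeA x p + strictSum I.E I.LeB x p = 1 ∧
      strictSum I.E I.LeA x p + weakSum I.E I.LeB x p = 1 ∧
      I.rowSum x p.1 = 1 ∧ I.colSum x p.2 = 1 := by
  obtain ⟨-, hrow, hcol, hb, hc, hnn⟩ := hx
  have hb' : ∀ p ∈ I.E, 0 ≤ weakSum I.E I.LeA x p + strictSum I.E I.LeB x p - 1 :=
    fun p hp => sub_nonneg.2 ((I.strongIneqB_iff x p).1 (hb p hp))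
  have hc' : ∀ p ∈ I.E, 0 ≤ strictSum I.E I.LeA x p + weakSum I.E I.LeB x p - 1 :=
    fun p hp => sub_nonneg.2 ((I.strongIneqC_iff x p).1 (hc p hp))
  have hsum : ∑ p ∈ I.E, x p *
      ((weakSum I.E I.LeA x p + strictSum I.E I.LeB x p - 1) +
      (strictSum I.E I.LeA x p + weakSum I.E I.LeB x p - 1) +
      (1 - I.rowSum x p.1) + (1 - I.colSum x p.2)) = 0 := by
    have hA := I.fiberPreorder_leA.sum_mul_strictSum_add_weakSum x
    have hB := I.fiberPreorder_leB.sum_mul_strictSum_add_weakSum x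
    rw [← sub_eq_zero, ← Finset.sum_sub_distrib] at hA hB
    have hAB := congrArg₂ (· + ·) hA hB
    simp only [← Finset.sum_add_distrib, add_zero] at hAB
    refine (Finset.sum_congr rfl fun q _ => ?_).trans hAB
    simp only [rowSum, colSum]
    ring
  have h0 := (Finset.sum_eq_zero_iff_of_nonneg (fun q hq => mul_nonneg (hnn q) (by
    linarith [hb' q hq, hc' q hq, hrow q.1, hcol q.2]))).1 hsum p hp
  have h1 := (mul_eq_zero.1 h0).resolve_left hpos.ne'
  have := hb' p hp
  have := hc' p hp
  have := hrow p.1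
  have := hcol p.2
  refine ⟨?_, ?_, ?_, ?_⟩ <;> linarith

/-- The edges of the support of `x` that are most preferred by their man within the support. -/
noncomputable def topEdges (I : SMInstance A B) (x : A × B → ℝ) : Finset (A × B) :=
  I.E.filter fun p => 0 < x p ∧ strictSum I.E I.LeA x p = 0

theorem mem_topEdges {p : A × B} :
    p ∈ I.topEdges x ↔ p ∈ I.E ∧ 0 < x p ∧ strictSum I.E I.LeA x p = 0 :=
  Finset.mem_filter

theorem StrongFeasible.weakSum_leB_of_mem_topEdges (hx : I.StrongFeasible x) {p : A × B}
    (hp : p ∈ I.topEdges x) : weakSum I.E I.LeB x p = 1 := by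
  obtain ⟨hpE, hpos, h0⟩ := mem_topEdges.1 hp
  have := (hx.tight_of_pos hpE hpos).2.1
  linarith

theorem StrongFeasible.strictSum_leB_lt_one (hx : I.StrongFeasible x) {p : A × B}
    (hp : p ∈ I.topEdges x) : strictSum I.E I.LeB x p < 1 := by
  rw [← hx.weakSum_leB_of_mem_topEdges hp]
  obtain ⟨hpE, hpos, -⟩ := mem_topEdges.1 hp
  exact I.fiberPreorder_leB.strictSum_lt_weakSum hx.2.2.2.2.2 hpE hpos

theorem StrongFeasible.weakSum_leA_pos (hx : I.StrongFeasible x) {p : A × B}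
    (hp : p ∈ I.topEdges x) : 0 < weakSum I.E I.LeA x p := by
  obtain ⟨hpE, hpos, h0⟩ := mem_topEdges.1 hp
  rw [← h0]
  exact I.fiberPreorder_leA.strictSum_lt_weakSum hx.2.2.2.2.2 hpE hpos

theorem StrongFeasible.leA_of_mem_topEdges (hx : I.StrongFeasible x) {p q : A × B}
    (hp : p ∈ I.topEdges x) (hq : q ∈ I.topEdges x) (hpq : p.1 = q.1) : I.LeA p q := by
  by_contra hn
  have hqp := I.fiberPreorder_leA.le_of_not_le (mem_topEdges.1 hp).1 (mem_topEdges.1 hq).1 hpq hn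
  have := I.fiberPreorder_leA.weakSum_le_strictSum hx.2.2.2.2.2 hqp hn
  rw [(mem_topEdges.1 hp).2.2] at this
  exact absurd (hx.weakSum_leA_pos hq) (not_lt.2 this)

theorem StrongFeasible.leB_of_mem_topEdges (hx : I.StrongFeasible x) {p q : A × B}
    (hp : p ∈ I.topEdges x) (hq : q ∈ I.topEdges x) (hpq : p.2 = q.2) : I.LeB p q := by
  by_contra hn
  have hqp := I.fiberPreorder_leB.le_of_not_le (mem_topEdges.1 hp).1 (mem_topEdges.1 hq).1 hpq hn
  have := I.fiberPreorder_leB.weakSum_le_strictSum hx.2.2.2.2.2 hqp hn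
  rw [hx.weakSum_leB_of_mem_topEdges hq] at this
  exact absurd (hx.strictSum_leB_lt_one hp) (not_lt.2 this)

/-- Rescaling `x` on the top edges gives row sums equal to one. -/
theorem StrongFeasible.row_sum_topEdges (hx : I.StrongFeasible x) {p : A × B}
    (hp : p ∈ I.topEdges x) :
    ∑ q ∈ (I.topEdges x).filter (fun q => q.1 = p.1), x q / weakSum I.E I.LeA x q = 1 := by
  have hnn := hx.2.2.2.2.2
  have hA := I.fiberPreorder_leA
  have h1 : ∀ q ∈ (I.topEdges x).filter (fun q => q.1 = p.1),
      x q / weakSum I.E I.LeA x q = x q / weakSum I.E I.LeA x p := by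
    intro q hq
    rw [Finset.mem_filter] at hq
    rw [le_antisymm (hA.weakSum_mono hnn (hx.leA_of_mem_topEdges hq.1 hp hq.2))
      (hA.weakSum_mono hnn (hx.leA_of_mem_topEdges hp hq.1 hq.2.symm))]
  rw [Finset.sum_congr rfl h1, ← Finset.sum_div, div_eq_one_iff_eq (hx.weakSum_leA_pos hp).ne']
  refine Finset.sum_subset (fun q hq => ?_) fun q hq hq' => ?_
  · rw [Finset.mem_filter] at hq ⊢
    exact ⟨(mem_topEdges.1 hq.1).1, hx.leA_of_mem_topEdges hq.1 hp hq.2⟩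
  · rw [Finset.mem_filter] at hq hq'
    refine le_antisymm (not_lt.1 fun hpos => hq' ⟨mem_topEdges.2 ⟨hq.1, hpos, ?_⟩, hq.2.1⟩) (hnn q)
    refine le_antisymm ?_ (Finset.sum_nonneg fun i _ => hnn i)
    rw [← (mem_topEdges.1 hp).2.2]
    exact hA.strictSum_mono hnn hq.2

/-- Rescaling `x` on the top edges gives column sums at most one. -/
theorem StrongFeasible.col_sum_topEdges_le (hx : I.StrongFeasible x) (v : B) :
    ∑ q ∈ (I.topEdges x).filter (fun q => q.2 = v), x q / weakSum I.E I.LeA x q ≤ 1 := by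
  have hnn := hx.2.2.2.2.2
  have hB := I.fiberPreorder_leB
  rcases Finset.eq_empty_or_nonempty ((I.topEdges x).filter fun q => q.2 = v) with he | ⟨p, hp⟩
  · rw [he, Finset.sum_empty]
    exact zero_le_one
  rw [Finset.mem_filter] at hp
  obtain ⟨hp, rfl⟩ := hp
  have hW : ∀ q ∈ I.topEdges x, weakSum I.E I.LeA x q = 1 - strictSum I.E I.LeB x q := by
    intro q hq
    have := (hx.tight_of_pos (mem_topEdges.1 hq).1 (mem_topEdges.1 hq).2.1).1
    linarith
  have h1 : ∀ q ∈ (I.topEdges x).filter (fun q => q.2 = p.2),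
      x q / weakSum I.E I.LeA x q = x q / weakSum I.E I.LeA x p := by
    intro q hq
    rw [Finset.mem_filter] at hq
    rw [hW q hq.1, hW p hp,
      le_antisymm (hB.strictSum_mono hnn (hx.leB_of_mem_topEdges hq.1 hp hq.2))
      (hB.strictSum_mono hnn (hx.leB_of_mem_topEdges hp hq.1 hq.2.symm))]
  rw [Finset.sum_congr rfl h1, ← Finset.sum_div, div_le_one (hx.weakSum_leA_pos hp), hW p hp,
    ← hx.weakSum_leB_of_mem_topEdges hp, weakSum_eq_strictSum_add, add_sub_cancel_left]
  refine Finset.sum_le_sum_of_subset_of_nonneg (fun q hq => ?_) fun i _ _ => hnn i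
  rw [Finset.mem_filter] at hq ⊢
  exact ⟨(mem_topEdges.1 hq.1).1, hx.leB_of_mem_topEdges hq.1 hp hq.2,
    hx.leB_of_mem_topEdges hp hq.1 hq.2.symm⟩

/-- The top edges contain a matching covering every vertex incident to the support. -/
theorem StrongFeasible.exists_matching_topEdges (hx : I.StrongFeasible x) :
    ∃ M ⊆ I.topEdges x, I.IsMatching M ∧ ∀ p ∈ I.E, 0 < x p →
      (∃ m ∈ M, m.1 = p.1) ∧ ∃ m ∈ M, m.2 = p.2 := by
  have hnn := hx.2.2.2.2.2
  set S := I.E.filter fun p => 0 < x p with hS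
  obtain ⟨M, hMH, hM1, hM2, hMU⟩ := exists_matching_of_row_sum_eq_one (I.topEdges x)
    (fun q => x q / weakSum I.E I.LeA x q)
    (fun q hq => div_nonneg (hnn q) (hx.weakSum_leA_pos hq).le) (S.image Prod.fst)
    (by
      intro u hu
      obtain ⟨p, hp, rfl⟩ := Finset.mem_image.1 hu
      rw [hS, Finset.mem_filter] at hp
      obtain ⟨q, hq, hqp, hqpos, hq0⟩ :=
        I.fiberPreorder_leA.exists_strictSum_eq_zero hnn hp.1 hp.2
      rw [← hqp]
      exact hx.row_sum_topEdges (mem_topEdges.2 ⟨hq, hqpos, hq0⟩))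
    hx.col_sum_topEdges_le
  have hcardA := card_image_support_eq_sum (f := Prod.fst) hnn
    fun p hp hpos => (hx.tight_of_pos hp hpos).2.2.1
  have hcardB := card_image_support_eq_sum (f := Prod.snd) hnn
    fun p hp hpos => (hx.tight_of_pos hp hpos).2.2.2
  have hcard : (S.image Prod.fst).card = (S.image Prod.snd).card := by
    exact_mod_cast hcardA.trans hcardB.symm
  have hMW : M.image Prod.snd = S.image Prod.snd := by
    refine Finset.eq_of_subset_of_card_le (Finset.image_subset_image fun q hq => ?_) ?_
    · have := mem_topEdges.1 (hMH hq)
      exact Finset.mem_filter.2 ⟨this.1, this.2.1⟩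
    · rw [← hcard, ← hMU, Finset.card_image_of_injOn fun p hp q hq => hM1 p hp q hq,
        Finset.card_image_of_injOn fun p hp q hq => hM2 p hp q hq]
  refine ⟨M, hMH, ⟨fun q hq => (mem_topEdges.1 (hMH hq)).1, hM1, hM2⟩, fun p hp hpos => ?_⟩
  have hpS : p ∈ S := Finset.mem_filter.2 ⟨hp, hpos⟩
  exact ⟨Finset.mem_image.1 (hMU ▸ Finset.mem_image_of_mem Prod.fst hpS),
    Finset.mem_image.1 (hMW ▸ Finset.mem_image_of_mem Prod.snd hpS)⟩

section Cover

variable {M : Finset (A × B)}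

theorem StrongFeasible.weakSum_leA_nonpos (hx : I.StrongFeasible x) (hM : M ⊆ I.topEdges x)
    (hcov : ∀ p ∈ I.E, 0 < x p → ∃ m ∈ M, m.1 = p.1) {p : A × B} (hp : p ∈ I.E)
    (h : ∀ m ∈ M, ¬ I.LeA m p) : weakSum I.E I.LeA x p ≤ 0 := by
  by_contra! hlt
  obtain ⟨r, hr, hrp, hpos⟩ := exists_pos_of_sum_filter_pos hlt
  obtain ⟨m, hm, hmr⟩ := hcov r hr hpos
  have hmE := mem_topEdges.1 (hM hm)
  have hpm := I.fiberPreorder_leA.le_of_not_le hmE.1 hp (hmr.trans hrp.1) (h m hm)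
  have := I.fiberPreorder_leA.weakSum_le_strictSum hx.2.2.2.2.2 hpm (h m hm)
  rw [hmE.2.2] at this
  linarith

theorem StrongFeasible.strictSum_leA_nonpos (hx : I.StrongFeasible x) (hM : M ⊆ I.topEdges x)
    (hcov : ∀ p ∈ I.E, 0 < x p → ∃ m ∈ M, m.1 = p.1) {p : A × B} (hp : p ∈ I.E)
    (h : ∀ m ∈ M, I.LeA m p → I.LeA p m) : strictSum I.E I.LeA x p ≤ 0 := by
  by_contra! hlt
  obtain ⟨r, hr, hrp, hpos⟩ := exists_pos_of_sum_filter_pos hlt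
  obtain ⟨m, hm, hmr⟩ := hcov r hr hpos
  have hmE := mem_topEdges.1 (hM hm)
  have hpm : I.LeA p m := by
    by_cases hmp : I.LeA m p
    · exact h m hm hmp
    · exact I.fiberPreorder_leA.le_of_not_le hmE.1 hp (hmr.trans hrp.1.1) hmp
  have := I.fiberPreorder_leA.strictSum_mono hx.2.2.2.2.2 hpm
  rw [hmE.2.2] at this
  linarith

theorem StrongFeasible.weakSum_leB_lt_one (hx : I.StrongFeasible x) (hM : M ⊆ I.topEdges x)
    (hcov : ∀ p ∈ I.E, 0 < x p → ∃ m ∈ M, m.2 = p.2) {p : A × B} (hp : p ∈ I.E)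
    (h : ∀ m ∈ M, ¬ I.LeB m p) : weakSum I.E I.LeB x p < 1 := by
  by_contra! hlt
  obtain ⟨r, hr, hrp, hpos⟩ := exists_pos_of_sum_filter_pos (zero_lt_one.trans_le hlt)
  obtain ⟨m, hm, hmr⟩ := hcov r hr hpos
  have hmE := mem_topEdges.1 (hM hm)
  have hpm := I.fiberPreorder_leB.le_of_not_le hmE.1 hp (hmr.trans hrp.1) (h m hm)
  have := I.fiberPreorder_leB.weakSum_le_strictSum hx.2.2.2.2.2 hpm (h m hm)
  linarith [hx.strictSum_leB_lt_one (hM hm)]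

theorem StrongFeasible.strictSum_leB_lt_one_of_forall (hx : I.StrongFeasible x)
    (hM : M ⊆ I.topEdges x) (hcov : ∀ p ∈ I.E, 0 < x p → ∃ m ∈ M, m.2 = p.2) {p : A × B}
    (hp : p ∈ I.E) (h : ∀ m ∈ M, I.LeB m p → I.LeB p m) : strictSum I.E I.LeB x p < 1 := by
  by_contra! hlt
  obtain ⟨r, hr, hrp, hpos⟩ := exists_pos_of_sum_filter_pos (zero_lt_one.trans_le hlt)
  obtain ⟨m, hm, hmr⟩ := hcov r hr hpos
  have hmE := mem_topEdges.1 (hM hm)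
  have hpm : I.LeB p m := by
    by_cases hmp : I.LeB m p
    · exact h m hm hmp
    · exact I.fiberPreorder_leB.le_of_not_le hmE.1 hp (hmr.trans hrp.1.1) hmp
  have := I.fiberPreorder_leB.strictSum_mono hx.2.2.2.2.2 hpm
  linarith [hx.strictSum_leB_lt_one (hM hm)]

theorem StrongFeasible.stronglyStable_of_subset_topEdges (hx : I.StrongFeasible x)
    (hM : M ⊆ I.topEdges x) (hmatch : I.IsMatching M)
    (hcov : ∀ p ∈ I.E, 0 < x p → (∃ m ∈ M, m.1 = p.1) ∧ ∃ m ∈ M, m.2 = p.2) :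
    I.StronglyStable M := by
  refine (I.stronglyStable_iff hmatch).2 fun p hp => ⟨?_, ?_⟩
  · by_contra! hc
    have h1 := hx.weakSum_leA_nonpos hM (fun p hp h => (hcov p hp h).1) hp hc.1
    have h2 := hx.strictSum_leB_lt_one_of_forall hM (fun p hp h => (hcov p hp h).2) hp hc.2
    linarith [(I.strongIneqB_iff x p).1 (hx.2.2.2.1 p hp)]
  · by_contra! hc
    have h1 := hx.strictSum_leA_nonpos hM (fun p hp h => (hcov p hp h).1) hp hc.1
    have h2 := hx.weakSum_leB_lt_one hM (fun p hp h => (hcov p hp h).2) hp hc.2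
    linarith [(I.strongIneqC_iff x p).1 (hx.2.2.2.2.1 p hp)]

theorem StrongFeasible.chi_tight_of_tightB (hx : I.StrongFeasible x) (hM : M ⊆ I.topEdges x)
    (hmatch : I.IsMatching M) {p : A × B}
    (h : weakSum I.E I.LeA x p + strictSum I.E I.LeB x p = 1) :
    weakSum I.E I.LeA (chi M) p + strictSum I.E I.LeB (chi M) p ≤ 1 := by
  rw [hmatch.weakSum_leA_chi, hmatch.strictSum_leB_chi]
  split_ifs with h1 h2 <;> norm_num
  obtain ⟨m, hm, hmp⟩ := h1
  obtain ⟨n, hn, hnp, hpn⟩ := h2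
  have := hx.weakSum_leA_pos (hM hm)
  have := I.fiberPreorder_leA.weakSum_mono hx.2.2.2.2.2 hmp
  have := I.fiberPreorder_leB.weakSum_le_strictSum hx.2.2.2.2.2 hnp hpn
  have := hx.weakSum_leB_of_mem_topEdges (hM hn)
  linarith

theorem StrongFeasible.chi_tight_of_tightC (hx : I.StrongFeasible x) (hM : M ⊆ I.topEdges x)
    (hmatch : I.IsMatching M) {p : A × B}
    (h : strictSum I.E I.LeA x p + weakSum I.E I.LeB x p = 1) :
    strictSum I.E I.LeA (chi M) p + weakSum I.E I.LeB (chi M) p ≤ 1 := by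
  rw [hmatch.strictSum_leA_chi, hmatch.weakSum_leB_chi]
  split_ifs with h1 h2 <;> norm_num
  obtain ⟨m, hm, hmp, hpm⟩ := h1
  obtain ⟨n, hn, hnp⟩ := h2
  have := hx.weakSum_leA_pos (hM hm)
  have := I.fiberPreorder_leA.weakSum_le_strictSum hx.2.2.2.2.2 hmp hpm
  have := I.fiberPreorder_leB.weakSum_mono hx.2.2.2.2.2 hnp
  have := hx.weakSum_leB_of_mem_topEdges (hM hn)
  linarith

theorem StrongFeasible.rowSum_le_rowSum_chi (hx : I.StrongFeasible x) (hmatch : I.IsMatching M)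
    (hcov : ∀ p ∈ I.E, 0 < x p → ∃ m ∈ M, m.1 = p.1) (a : A) :
    I.rowSum x a ≤ I.rowSum (chi M) a := by
  rw [hmatch.rowSum_chi]
  split_ifs with h
  · exact hx.2.1 a
  · by_contra! hlt
    obtain ⟨r, hr, rfl, hpos⟩ := exists_pos_of_sum_filter_pos hlt
    exact h (hcov r hr hpos)

theorem StrongFeasible.colSum_le_colSum_chi (hx : I.StrongFeasible x) (hmatch : I.IsMatching M)
    (hcov : ∀ p ∈ I.E, 0 < x p → ∃ m ∈ M, m.2 = p.2) (b : B) :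
    I.colSum x b ≤ I.colSum (chi M) b := by
  rw [hmatch.colSum_chi]
  split_ifs with h
  · exact hx.2.2.1 b
  · by_contra! hlt
    obtain ⟨r, hr, rfl, hpos⟩ := exists_pos_of_sum_filter_pos hlt
    exact h (hcov r hr hpos)

end Cover

/-- A feasible `x` can be moved slightly away from the incidence vector of a matching of top edges
that covers its support. -/
theorem StrongFeasible.eventually_strongFeasible {M : Finset (A × B)} (hx : I.StrongFeasible x)
    (hM : M ⊆ I.topEdges x) (hmatch : I.IsMatching M)
    (hcov : ∀ p ∈ I.E, 0 < x p → (∃ m ∈ M, m.1 = p.1) ∧ ∃ m ∈ M, m.2 = p.2) :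
    ∀ᶠ δ in 𝓝[>] (0 : ℝ), I.StrongFeasible fun p => x p + δ * (x p - chi M p) := by
  have hB := (Filter.eventually_all_finset (l := 𝓝[>] (0 : ℝ)) I.E).2 fun p hp =>
    eventually_le_add_mul_sub ((I.strongIneqB_iff x p).1 (hx.2.2.2.1 p hp)) fun h =>
      hx.chi_tight_of_tightB hM hmatch h
  have hC := (Filter.eventually_all_finset (l := 𝓝[>] (0 : ℝ)) I.E).2 fun p hp =>
    eventually_le_add_mul_sub ((I.strongIneqC_iff x p).1 (hx.2.2.2.2.1 p hp)) fun h =>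
      hx.chi_tight_of_tightC hM hmatch h
  have hN := (Filter.eventually_all_finset (l := 𝓝[>] (0 : ℝ)) I.E).2 fun p hp =>
    eventually_le_add_mul_sub (m := chi M p) (hx.2.2.2.2.2 p) fun h =>
      (if_neg fun hpM => (mem_topEdges.1 (hM hpM)).2.1.ne' h : chi M p = 0).le
  have hchi : ∀ p ∉ I.E, chi M p = 0 := fun p hp => if_neg fun hpM => hp (hmatch.1 hpM)
  filter_upwards [hB, hC, hN, self_mem_nhdsWithin] with δ hB hC hN hδ
  have hδ : 0 < δ := hδ
  refine ⟨fun p hp => ?_, fun a => ?_, fun b => ?_, fun p hp => ?_, fun p hp => ?_, fun p => ?_⟩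
  · simp only [hx.1 p hp, hchi p hp, sub_zero, mul_zero, add_zero]
  · have h1 := hx.rowSum_le_rowSum_chi hmatch (fun p hp h => (hcov p hp h).1) a
    have h2 := hx.2.1 a
    unfold rowSum at h1 h2 ⊢
    rw [sum_filter_add_mul_sub]
    nlinarith
  · have h1 := hx.colSum_le_colSum_chi hmatch (fun p hp h => (hcov p hp h).2) b
    have h2 := hx.2.2.1 b
    unfold colSum at h1 h2 ⊢
    rw [sum_filter_add_mul_sub]
    nlinarith
  · rw [strongIneqB_iff]
    have := hB p hp
    unfold weakSum strictSum at this ⊢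
    rw [sum_filter_add_mul_sub, sum_filter_add_mul_sub]
    linarith
  · rw [strongIneqC_iff]
    have := hC p hp
    unfold weakSum strictSum at this ⊢
    rw [sum_filter_add_mul_sub, sum_filter_add_mul_sub]
    linarith
  · by_cases hp : p ∈ I.E
    · exact hN p hp
    · simp only [hx.1 p hp, hchi p hp, sub_zero, mul_zero, add_zero, le_refl]

theorem exists_stronglyStable_of_mem_extremePoints
    (hx : x ∈ Set.extremePoints ℝ {y | I.StrongFeasible y}) :
    ∃ M, I.StronglyStable M ∧ x = chi M := by
  have hf : I.StrongFeasible x := hx.1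
  obtain ⟨M, hM, hmatch, hcov⟩ := hf.exists_matching_topEdges
  have hst := hf.stronglyStable_of_subset_topEdges hM hmatch hcov
  obtain ⟨δ, hδ, hpos⟩ := ((hf.eventually_strongFeasible hM hmatch hcov).and
    self_mem_nhdsWithin).exists
  have hpos : 0 < δ := hpos
  refine ⟨M, hst, (hx.2 hst.strongFeasible_chi hδ ?_).symm⟩
  refine ⟨δ / (1 + δ), 1 / (1 + δ), by positivity, by positivity, by field_simp; ring, ?_⟩
  ext p
  simp only [Pi.add_apply, Pi.smul_apply, smul_eq_mul]
  field_simp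
  ring

end SMInstance

/-- The strongly stable matching polytope is integral: `x ∈ ℝ^E` is an extreme point
of the polytope defined by the strongly stable matching linear system (a)–(d) iff
`x = χ^M` for some strongly stable matching `M` of `G`. -/
theorem strongly_stable_polytope_integral {A B : Type*} (I : SMInstance A B) :
    ∀ x : A × B → ℝ,
      x ∈ Set.extremePoints ℝ {y | I.StrongFeasible y} ↔
        ∃ M, I.StronglyStable M ∧ x = SMInstance.chi M := by
  intro x
  refine ⟨SMInstance.exists_stronglyStable_of_mem_extremePoints, ?_⟩
  rintro ⟨M, hM, rfl⟩
  exact hM.chi_mem_extremePoints
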